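/- Let P(ζ) = ∏_{j=1}^4 (ζ - γ_j) with real roots γ_1 ≤ γ_2 ≤ γ_3 ≤ γ_4, let m = (γ_1+γ_2+γ_3+γ_4)/4 and σ^2 = (1/4)∑_j (γ_j - m)^2. If a real number α satisfies α ∈ (-∞,γ_1) ∪ (γ_2,γ_3) ∪ (γ_4,∞) and |α - m| < σ/√3, then Re P(iξ + α) ≥ c(1 + ξ^4) for all ξ ∈ ℝ and some constant c > 0. -/

import Mathlib

/-- Coercivity criterion for a monic quartic with real roots: if `α` avoids the intervals
`[γ₁,γ₂]` and `[γ₃,γ₄]` and lies within `σ/√3` of the mean `m` of the roots, then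
`Re P(iξ + α) ≥ c(1 + ξ⁴)` for some `c > 0`. -/
theorem stmt_7 (γ₁ γ₂ γ₃ γ₄ α : ℝ) (h₁₂ : γ₁ ≤ γ₂) (h₂₃ : γ₂ ≤ γ₃) (h₃₄ : γ₃ ≤ γ₄)
    (hroots : α < γ₁ ∨ (γ₂ < α ∧ α < γ₃) ∨ γ₄ < α)
    (hvar : |α - (γ₁ + γ₂ + γ₃ + γ₄) / 4| <
      Real.sqrt ((1 / 4) * ((γ₁ - (γ₁ + γ₂ + γ₃ + γ₄) / 4) ^ 2 +
        (γ₂ - (γ₁ + γ₂ + γ₃ + γ₄) / 4) ^ 2 + (γ₃ - (γ₁ + γ₂ + γ₃ + γ₄) / 4) ^ 2 +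
        (γ₄ - (γ₁ + γ₂ + γ₃ + γ₄) / 4) ^ 2)) / Real.sqrt 3) :
    ∃ c > (0 : ℝ), ∀ ξ : ℝ,
      c * (1 + ξ ^ 4) ≤
        (((ξ : ℂ) * Complex.I + (α : ℂ) - (γ₁ : ℂ)) * ((ξ : ℂ) * Complex.I + (α : ℂ) - (γ₂ : ℂ)) *
          ((ξ : ℂ) * Complex.I + (α : ℂ) - (γ₃ : ℂ)) *
          ((ξ : ℂ) * Complex.I + (α : ℂ) - (γ₄ : ℂ))).re := by
  have he4 : 0 < (α - γ₁) * (α - γ₂) * ((α - γ₃) * (α - γ₄)) := by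
    rcases hroots with h | ⟨h, h'⟩ | h
    · exact mul_pos (mul_pos_of_neg_of_neg (by linarith) (by linarith))
        (mul_pos_of_neg_of_neg (by linarith) (by linarith))
    · exact mul_pos (mul_pos (by linarith) (by linarith))
        (mul_pos_of_neg_of_neg (by linarith) (by linarith))
    · exact mul_pos (mul_pos (by linarith) (by linarith))
        (mul_pos (by linarith) (by linarith))
  have he2 : (α - γ₁) * (α - γ₂) + (α - γ₁) * (α - γ₃) + (α - γ₁) * (α - γ₄) +
      (α - γ₂) * (α - γ₃) + (α - γ₂) * (α - γ₄) + (α - γ₃) * (α - γ₄) < 0 := by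
    rw [← Real.sqrt_div' _ (by norm_num : (0 : ℝ) ≤ 3), Real.lt_sqrt (abs_nonneg _), sq_abs,
      lt_div_iff₀ (by norm_num)] at hvar
    linarith
  refine ⟨min 1 ((α - γ₁) * (α - γ₂) * ((α - γ₃) * (α - γ₄))), lt_min one_pos he4, fun ξ => ?_⟩
  have hre : (((ξ : ℂ) * Complex.I + (α : ℂ) - (γ₁ : ℂ)) *
      ((ξ : ℂ) * Complex.I + (α : ℂ) - (γ₂ : ℂ)) * ((ξ : ℂ) * Complex.I + (α : ℂ) - (γ₃ : ℂ)) *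
      ((ξ : ℂ) * Complex.I + (α : ℂ) - (γ₄ : ℂ))).re =
      ξ ^ 4 - ((α - γ₁) * (α - γ₂) + (α - γ₁) * (α - γ₃) + (α - γ₁) * (α - γ₄) +
        (α - γ₂) * (α - γ₃) + (α - γ₂) * (α - γ₄) + (α - γ₃) * (α - γ₄)) * ξ ^ 2 +
        (α - γ₁) * (α - γ₂) * ((α - γ₃) * (α - γ₄)) := by
    simp
    ring
  rw [hre]
  have hquad := mul_nonpos_of_nonpos_of_nonneg he2.le (sq_nonneg ξ)
  have hquart := mul_le_mul_of_nonneg_right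
    (min_le_left 1 ((α - γ₁) * (α - γ₂) * ((α - γ₃) * (α - γ₄)))) (by positivity : 0 ≤ ξ ^ 4)
  have hconst := min_le_right 1 ((α - γ₁) * (α - γ₂) * ((α - γ₃) * (α - γ₄)))
  linarith
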